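/- Let μ be an element of M and let γ ∈ R be a root with ⟨γ, μ⟩ ≥ 2 (so μ = γ∨ is a quasi-minuscule cocharacter). Then Ω(μ) = Wμ ∪ {0}, and ⟨α, μ⟩ ∈ {−1, 0, 1} for every root α ∈ R ∖ {γ, −γ}. -/

import Mathlib

open scoped BigOperators Classical

noncomputable section

/-- Data of a finite crystallographic root system in a pair of vector spaces `V`, `V'`
(in perfect duality via `pair`), with a chosen base `Δ` and a cocharacter lattice `X`. -/
structure RootSystemData (V V' : Type) [AddCommGroup V] [Module ℝ V]
    [FiniteDimensional ℝ V] [AddCommGroup V'] [Module ℝ V'] [FiniteDimensional ℝ V'] where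
  /-- The canonical pairing between `V` and `V'`. -/
  pair : V →ₗ[ℝ] V' →ₗ[ℝ] ℝ
  /-- The (finite) set of roots. -/
  R : Finset V
  /-- The coroot attached to a root. -/
  coroot : V → V'
  root_ne_zero : ∀ α ∈ R, α ≠ (0 : V)
  neg_mem : ∀ α ∈ R, -α ∈ R
  coroot_neg : ∀ α ∈ R, coroot (-α) = -coroot α
  pair_self_eq_two : ∀ α ∈ R, pair α (coroot α) = 2
  crystallographic : ∀ α ∈ R, ∀ β ∈ R, ∃ n : ℤ, pair α (coroot β) = (n : ℝ)
  reflect_root_mem : ∀ α ∈ R, ∀ β ∈ R, β - pair β (coroot α) • α ∈ R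
  reflect_coroot_mem : ∀ α ∈ R, ∀ β ∈ R,
    coroot β - pair α (coroot β) • coroot α ∈ coroot '' R
  /-- The chosen base (set of simple roots). -/
  Δ : Finset V
  base_subset : Δ ⊆ R
  base_indep : LinearIndependent ℝ (fun a : (Δ : Set V) => (a : V))
  base_generates : ∀ α ∈ R,
    α ∈ AddSubmonoid.closure (Δ : Set V) ∨ -α ∈ AddSubmonoid.closure (Δ : Set V)
  /-- The lattice `X∨`. -/
  X : AddSubgroup V'
  coroot_mem_X : ∀ α ∈ R, coroot α ∈ X
  X_le_span : (X : Set V') ⊆ (Submodule.span ℝ (coroot '' (R : Set V)) : Set V')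
  pair_X_int : ∀ α ∈ R, ∀ x ∈ X, ∃ n : ℤ, pair α x = (n : ℝ)

namespace RootSystemData

variable {V V' : Type} [AddCommGroup V] [Module ℝ V] [FiniteDimensional ℝ V]
  [AddCommGroup V'] [Module ℝ V'] [FiniteDimensional ℝ V']
  (D : RootSystemData V V')

/-- The set `R₊` of positive roots: roots which are `ℕ`-linear combinations of the base. -/
def Rpos : Finset V := D.R.filter fun α => α ∈ AddSubmonoid.closure (D.Δ : Set V)

/-- The coroot lattice `Q∨`. -/
def Qc : AddSubgroup V' := AddSubgroup.closure (D.coroot '' (D.R : Set V))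

/-- The positive cone `Q∨₊` generated by the coroots of the positive roots. -/
def Qpos : AddSubmonoid V' := AddSubmonoid.closure (D.coroot '' (D.Rpos : Set V))

/-- The dominance order: `ν ≤ λ` iff `λ - ν ∈ Q∨₊`. -/
def leQ (ν lam : V') : Prop := lam - ν ∈ D.Qpos

/-- Dominance: `ν` is dominant iff `⟨α, ν⟩ ≥ 0` for every positive root `α`. -/
def Dominant (ν : V') : Prop := ∀ α ∈ D.Rpos, 0 ≤ D.pair α ν

/-- The set `X∨₊` of dominant elements of the lattice. -/
def Xplus : Set V' := {x | x ∈ D.X ∧ D.Dominant x}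

/-- The set `M` of minimal elements of `X∨₊ \ {0}` for the dominance order. -/
def MSet : Set V' :=
  {μ | μ ∈ D.Xplus ∧ μ ≠ 0 ∧ ∀ ν ∈ D.Xplus, ν ≠ 0 → D.leQ ν μ → ν = μ}

/-- The reflection on `V` attached to a root `α`. -/
def reflV (α : V) (hα : α ∈ D.R) : V ≃ₗ[ℝ] V :=
  Module.reflection (show D.pair.flip (D.coroot α) α = 2 from D.pair_self_eq_two α hα)

/-- The reflection on `V'` attached to a root `α`. -/
def reflV' (α : V) (hα : α ∈ D.R) : V' ≃ₗ[ℝ] V' :=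
  Module.reflection (show D.pair α (D.coroot α) = 2 from D.pair_self_eq_two α hα)

/-- The Weyl group `W`, acting simultaneously on `V` (first component)
and on `V'` (second component); it is generated by the pairs of reflections
attached to the roots. -/
def weyl : Subgroup ((V ≃ₗ[ℝ] V) × (V' ≃ₗ[ℝ] V')) :=
  Subgroup.closure {g | ∃ α, ∃ hα : α ∈ D.R, g = (D.reflV α hα, D.reflV' α hα)}

/-- The orbit `Wμ` of `μ ∈ V'` under the Weyl group. -/
def Worbit (μ : V') : Set V' := {ν | ∃ g ∈ D.weyl, ν = g.2 μ}

/-- The set `Ω(λ) = {ν ∈ X∨ : wν ≤ λ for all w ∈ W}`. -/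
def Omega (lam : V') : Set V' :=
  {ν | ν ∈ D.X ∧ ∀ g ∈ D.weyl, D.leQ (g.2 ν) lam}

/-- Two roots are linked when they are non-orthogonal. -/
def Linked (α β : V) : Prop := α ∈ D.R ∧ β ∈ D.R ∧ D.pair α (D.coroot β) ≠ 0

/-- Two roots lie in the same irreducible component iff they are connected by a
chain of non-orthogonal roots. -/
def SameComponent (α β : V) : Prop := Relation.EqvGen D.Linked α β

/-- The half-sum `ρ` of the positive roots. -/
def rho : V := (2 : ℝ)⁻¹ • ∑ α ∈ D.Rpos, α

/-- A `W`-invariant inner product on `V'`. -/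
structure WInvInner where
  form : V' →ₗ[ℝ] V' →ₗ[ℝ] ℝ
  symm : ∀ x y, form x y = form y x
  posdef : ∀ x, x ≠ 0 → 0 < form x x
  invariant : ∀ g ∈ D.weyl, ∀ x y, form (g.2 x) (g.2 y) = form x y

/-- `β` is a root whose coroot is short: for every `W`-invariant inner product `B` on `V'`,
`B(β∨, β∨) ≤ B(α∨, α∨)` for every root `α` in the same irreducible component as `β`. -/
def IsShortCoroot (β : V) : Prop :=
  β ∈ D.R ∧ ∀ B : D.WInvInner, ∀ α ∈ D.R, D.SameComponent α β →
    B.form (D.coroot β) (D.coroot β) ≤ B.form (D.coroot α) (D.coroot α)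

end RootSystemData

namespace RootSystemData

variable {V V' : Type} [AddCommGroup V] [Module ℝ V] [FiniteDimensional ℝ V]
  [AddCommGroup V'] [Module ℝ V'] [FiniteDimensional ℝ V']
  (D : RootSystemData V V')

/-! ### Reflections -/

/-- The reflection attached to a root, as an element of the group containing the Weyl group. -/
def refl (α : V) (hα : α ∈ D.R) : (V ≃ₗ[ℝ] V) × (V' ≃ₗ[ℝ] V') :=
  (D.reflV α hα, D.reflV' α hα)

lemma refl_fst_apply {α : V} (hα : α ∈ D.R) (v : V) :
    (D.refl α hα).1 v = v - D.pair v (D.coroot α) • α :=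
  Module.reflection_apply v (show D.pair.flip (D.coroot α) α = 2 from D.pair_self_eq_two α hα)

lemma refl_snd_apply {α : V} (hα : α ∈ D.R) (x : V') :
    (D.refl α hα).2 x = x - D.pair α x • D.coroot α :=
  Module.reflection_apply x (D.pair_self_eq_two α hα)

lemma refl_inv {α : V} (hα : α ∈ D.R) : (D.refl α hα)⁻¹ = D.refl α hα := rfl

lemma refl_mul_self {α : V} (hα : α ∈ D.R) : D.refl α hα * D.refl α hα = 1 := by
  nth_rewrite 1 [← D.refl_inv hα]
  exact inv_mul_cancel _

lemma refl_mem_weyl {α : V} (hα : α ∈ D.R) : D.refl α hα ∈ D.weyl :=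
  Subgroup.subset_closure ⟨α, hα, rfl⟩

lemma weyl_induction {p : (w : (V ≃ₗ[ℝ] V) × (V' ≃ₗ[ℝ] V')) → w ∈ D.weyl → Prop}
    (one : p 1 (one_mem _))
    (refl_mul : ∀ α (hα : α ∈ D.R) w (hw : w ∈ D.weyl), p w hw →
      p (D.refl α hα * w) (mul_mem (D.refl_mem_weyl hα) hw))
    {w : (V ≃ₗ[ℝ] V) × (V' ≃ₗ[ℝ] V')} (hw : w ∈ D.weyl) : p w hw := by
  induction hw using Subgroup.closure_induction_left with
  | one => exact one
  | mul_left g hg w hw ih =>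
    obtain ⟨α, hα, rfl⟩ := hg
    exact refl_mul α hα w hw ih
  | inv_mul_cancel g hg w hw ih =>
    obtain ⟨α, hα, rfl⟩ := hg
    exact refl_mul α hα w hw ih

lemma refl_fst_mem {α β : V} (hα : α ∈ D.R) (hβ : β ∈ D.R) : (D.refl α hα).1 β ∈ D.R := by
  rw [refl_fst_apply]
  exact D.reflect_root_mem α hα β hβ

lemma pair_refl_refl {α : V} (hα : α ∈ D.R) (v : V) (x : V') :
    D.pair ((D.refl α hα).1 v) ((D.refl α hα).2 x) = D.pair v x := by
  simp only [refl_fst_apply, refl_snd_apply, map_sub, map_smul, LinearMap.sub_apply,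
    LinearMap.smul_apply, smul_eq_mul, D.pair_self_eq_two α hα]
  ring

lemma refl_fst_refl_fst {α : V} (hα : α ∈ D.R) (v : V) :
    (D.refl α hα).1 ((D.refl α hα).1 v) = v :=
  congrArg (fun g => g.1 v) (D.refl_mul_self hα)

/-! ### The map `x ↦ ∑ ⟨α, x⟩ α` -/

/-- The `W`-equivariant map `x ↦ ∑ ⟨α, x⟩ α` from `V'` to `V`. -/
def polarization : V' →ₗ[ℝ] V := ∑ α ∈ D.R, (D.pair α).smulRight α

lemma polarization_apply (x : V') : D.polarization x = ∑ α ∈ D.R, D.pair α x • α := by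
  simp [polarization]

lemma polarization_refl {α : V} (hα : α ∈ D.R) (x : V') :
    D.polarization ((D.refl α hα).2 x) = (D.refl α hα).1 (D.polarization x) := by
  rw [polarization_apply, polarization_apply, map_sum]
  refine Finset.sum_nbij' (D.refl α hα).1 (D.refl α hα).1
    (fun β hβ => D.refl_fst_mem hα hβ) (fun β hβ => D.refl_fst_mem hα hβ)
    (fun β _ => D.refl_fst_refl_fst hα β) (fun β _ => D.refl_fst_refl_fst hα β) fun β _ => ?_
  rw [map_smul, refl_fst_refl_fst, ← D.pair_refl_refl hα ((D.refl α hα).1 β), refl_fst_refl_fst]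

lemma polarization_coroot {β : V} (hβ : β ∈ D.R) :
    ∃ c : ℝ, 0 < c ∧ D.polarization (D.coroot β) = c • β := by
  refine ⟨2⁻¹ * D.pair (D.polarization (D.coroot β)) (D.coroot β), ?_, ?_⟩
  · have hpos : 0 < D.pair (D.polarization (D.coroot β)) (D.coroot β) := by
      simp only [polarization_apply, map_sum, map_smul, LinearMap.sum_apply,
        LinearMap.smul_apply, smul_eq_mul]
      refine Finset.sum_pos' (fun α _ => mul_self_nonneg _) ⟨β, hβ, ?_⟩
      rw [D.pair_self_eq_two β hβ]
      norm_num
    positivity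
  · have h := D.polarization_refl hβ (D.coroot β)
    rw [refl_snd_apply, refl_fst_apply, D.pair_self_eq_two β hβ, map_sub, map_smul] at h
    rw [mul_smul]
    generalize D.pair (D.polarization (D.coroot β)) (D.coroot β) • β = y at h ⊢
    have h' : y = (2 : ℝ) • D.polarization (D.coroot β) := by
      simpa using h.symm
    rw [h', smul_smul]
    norm_num

lemma pair_coroot_pos_symm {α β : V} (hα : α ∈ D.R) (hβ : β ∈ D.R)
    (h : 0 < D.pair α (D.coroot β)) : 0 < D.pair β (D.coroot α) := by
  obtain ⟨a, ha, haα⟩ := D.polarization_coroot hα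
  obtain ⟨b, hb, hbβ⟩ := D.polarization_coroot hβ
  have key : D.pair (D.polarization (D.coroot α)) (D.coroot β)
      = D.pair (D.polarization (D.coroot β)) (D.coroot α) := by
    simp only [polarization_apply, map_sum, map_smul, LinearMap.sum_apply,
      LinearMap.smul_apply, smul_eq_mul, mul_comm]
  rw [haα, hbβ] at key
  simp only [map_smul, LinearMap.smul_apply, smul_eq_mul] at key
  exact pos_of_mul_pos_right (key ▸ mul_pos ha h) hb.le

/-- Proportional vectors with the same nonzero pairing with `x` are equal. -/
lemma eq_of_smul_eq_smul {δ ε : V} {x : V'} {a b : ℝ} (ha : 0 < a) (h : a • δ = b • ε)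
    (hδ : D.pair δ x = 2) (hε : D.pair ε x = 2) : δ = ε := by
  have hab : a = b := by
    have := congrArg (fun v => D.pair v x) h
    simp only [map_smul, LinearMap.smul_apply, smul_eq_mul, hδ, hε] at this
    linarith
  subst hab
  exact smul_right_injective V ha.ne' h

lemma coroot_injOn {α β : V} (hα : α ∈ D.R) (hβ : β ∈ D.R)
    (h : D.coroot α = D.coroot β) : α = β := by
  obtain ⟨a, ha, haα⟩ := D.polarization_coroot hα
  obtain ⟨b, hb, hbβ⟩ := D.polarization_coroot hβ
  rw [h, hbβ] at haα
  exact D.eq_of_smul_eq_smul ha haα.symm (h ▸ D.pair_self_eq_two α hα) (D.pair_self_eq_two β hβ)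

lemma coroot_refl {α β : V} (hα : α ∈ D.R) (hβ : β ∈ D.R) :
    D.coroot ((D.refl α hα).1 β) = (D.refl α hα).2 (D.coroot β) := by
  obtain ⟨δ, hδ, hδe⟩ := D.reflect_coroot_mem α hα β hβ
  rw [← refl_snd_apply D hα] at hδe
  obtain ⟨d, hd, hdδ⟩ := D.polarization_coroot hδ
  obtain ⟨b, hb, hbβ⟩ := D.polarization_coroot hβ
  have h := D.polarization_refl hα (D.coroot β)
  rw [← hδe, hdδ, hbβ, map_smul] at h
  rw [← hδe, D.eq_of_smul_eq_smul hd h (D.pair_self_eq_two δ hδ)]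
  rw [hδe, pair_refl_refl]
  exact D.pair_self_eq_two β hβ

lemma coroot_smul {α : V} {t : ℝ} (hα : α ∈ D.R) (hβ : t • α ∈ D.R) :
    D.coroot α = t • D.coroot (t • α) := by
  have h := D.coroot_refl hα hβ
  have hneg : (D.refl α hα).1 (t • α) = -(t • α) := by
    rw [map_smul, refl_fst_apply, D.pair_self_eq_two α hα, two_smul]
    simp
  rw [hneg, D.coroot_neg _ hβ, refl_snd_apply] at h
  have h2 := D.pair_self_eq_two _ hβ
  rw [map_smul, LinearMap.smul_apply, smul_eq_mul] at h2
  generalize D.coroot (t • α) = y at h h2 ⊢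
  have h3 : D.pair α y • D.coroot α = (2 : ℝ) • y := by
    rw [two_smul]
    exact neg_add_eq_iff_eq_add.1 (eq_sub_iff_add_eq.1 h)
  have h4 : (2 : ℝ) • D.coroot α = (2 : ℝ) • (t • y) := by
    rw [← h2, mul_smul, h3, smul_comm, h2]
  exact smul_right_injective V' two_ne_zero h4

lemma refl_smul {α : V} {t : ℝ} (hα : α ∈ D.R) (hβ : t • α ∈ D.R) :
    D.refl (t • α) hβ = D.refl α hα := by
  have h := D.coroot_smul hα hβ
  refine Prod.ext (LinearEquiv.ext fun v => ?_) (LinearEquiv.ext fun x => ?_)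
  · rw [refl_fst_apply, refl_fst_apply, h, map_smul, smul_eq_mul, smul_smul, mul_comm]
  · rw [refl_snd_apply, refl_snd_apply, h, map_smul, LinearMap.smul_apply, smul_smul,
      smul_eq_mul, mul_comm]

lemma refl_neg {α : V} (hα : α ∈ D.R) : D.refl (-α) (D.neg_mem α hα) = D.refl α hα := by
  have h := D.refl_smul (t := -1) hα (by simpa using D.neg_mem α hα)
  simpa using h

/-! ### The Weyl group -/

section Weyl

variable {D} {w : (V ≃ₗ[ℝ] V) × (V' ≃ₗ[ℝ] V')}

lemma pair_weyl (hw : w ∈ D.weyl) (v : V) (x : V') : D.pair (w.1 v) (w.2 x) = D.pair v x := by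
  induction hw using D.weyl_induction with
  | one => rfl
  | refl_mul α hα w hw ih => exact (D.pair_refl_refl hα _ _).trans ih

lemma weyl_root_mem (hw : w ∈ D.weyl) {β : V} (hβ : β ∈ D.R) : w.1 β ∈ D.R := by
  induction hw using D.weyl_induction with
  | one => exact hβ
  | refl_mul α hα w hw ih => exact D.refl_fst_mem hα ih

lemma coroot_weyl (hw : w ∈ D.weyl) {β : V} (hβ : β ∈ D.R) :
    D.coroot (w.1 β) = w.2 (D.coroot β) := by
  induction hw using D.weyl_induction with
  | one => rfl
  | refl_mul α hα w hw ih =>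
    exact (D.coroot_refl hα (weyl_root_mem hw hβ)).trans (congrArg _ ih)

lemma sub_pair_smul_mem_X {α : V} (hα : α ∈ D.R) {x y : V'} (hx : x ∈ D.X) (hy : y ∈ D.X) :
    x - D.pair α y • D.coroot α ∈ D.X := by
  obtain ⟨n, hn⟩ := D.pair_X_int α hα y hy
  rw [hn, Int.cast_smul_eq_zsmul]
  exact D.X.sub_mem hx (D.X.zsmul_mem (D.coroot_mem_X α hα) n)

lemma weyl_mem_X (hw : w ∈ D.weyl) {x : V'} (hx : x ∈ D.X) : w.2 x ∈ D.X := by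
  induction hw using D.weyl_induction with
  | one => exact hx
  | refl_mul α hα w hw ih =>
    change (D.refl α hα).2 (w.2 x) ∈ D.X
    rw [refl_snd_apply]
    exact sub_pair_smul_mem_X hα ih ih

lemma mul_refl (hw : w ∈ D.weyl) {α : V} (hα : α ∈ D.R) :
    w * D.refl α hα = D.refl (w.1 α) (weyl_root_mem hw hα) * w := by
  refine Prod.ext (LinearEquiv.ext fun v => ?_) (LinearEquiv.ext fun x => ?_)
  · change w.1 ((D.refl α hα).1 v) = (D.refl (w.1 α) (weyl_root_mem hw hα)).1 (w.1 v)
    rw [refl_fst_apply, refl_fst_apply, coroot_weyl hw hα, pair_weyl hw, map_sub, map_smul]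
  · change w.2 ((D.refl α hα).2 x) = (D.refl (w.1 α) (weyl_root_mem hw hα)).2 (w.2 x)
    rw [refl_snd_apply, refl_snd_apply, coroot_weyl hw hα, pair_weyl hw, map_sub, map_smul]

end Weyl

/-! ### Heights -/

lemma exists_coords : ∃ φ : V →ₗ[ℝ] ((D.Δ : Set V) →₀ ℝ),
    ∀ δ : (D.Δ : Set V), φ δ = Finsupp.single δ 1 := by
  obtain ⟨φ, hφ⟩ := (Finsupp.linearCombination ℝ
    (fun a : (D.Δ : Set V) => (a : V))).exists_leftInverse_of_injective
      (LinearMap.ker_eq_bot.2 D.base_indep)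
  refine ⟨φ, fun δ => ?_⟩
  simpa using LinearMap.congr_fun hφ (Finsupp.single δ 1)

/-- A linear map which computes coordinates with respect to the base on the span of the roots. -/
def coords : V →ₗ[ℝ] ((D.Δ : Set V) →₀ ℝ) := D.exists_coords.choose

lemma coords_base (δ : (D.Δ : Set V)) : D.coords δ = Finsupp.single δ 1 :=
  D.exists_coords.choose_spec δ

/-- The height: a linear form equal to `1` on the base. -/
def height : V →ₗ[ℝ] ℝ := Finsupp.linearCombination ℝ (fun _ => (1 : ℝ)) ∘ₗ D.coords

lemma height_base {δ : V} (hδ : δ ∈ D.Δ) : D.height δ = 1 := by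
  simp [height, D.coords_base ⟨δ, hδ⟩]

lemma height_closure {v : V} (hv : v ∈ AddSubmonoid.closure (D.Δ : Set V)) :
    ∃ n : ℕ, D.height v = n ∧ (n = 0 → v = 0) := by
  induction hv using AddSubmonoid.closure_induction with
  | mem δ hδ => exact ⟨1, by simp [D.height_base hδ], by simp⟩
  | zero => exact ⟨0, by simp, fun _ => rfl⟩
  | add x y _ _ hx hy =>
    obtain ⟨n, hn, hn0⟩ := hx
    obtain ⟨m, hm, hm0⟩ := hy
    refine ⟨n + m, by simp [hn, hm], fun h => ?_⟩
    rw [hn0 (by omega), hm0 (by omega), add_zero]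

lemma coords_nonneg {v : V} (hv : v ∈ AddSubmonoid.closure (D.Δ : Set V)) (δ : (D.Δ : Set V)) :
    0 ≤ D.coords v δ := by
  induction hv using AddSubmonoid.closure_induction with
  | mem ε hε =>
    rw [D.coords_base ⟨ε, hε⟩, Finsupp.single_apply]
    split_ifs <;> norm_num
  | zero => simp
  | add x y _ _ hx hy =>
    rw [map_add, Finsupp.add_apply]
    exact add_nonneg hx hy

lemma linearCombination_coords {v : V} (hv : v ∈ AddSubmonoid.closure (D.Δ : Set V)) :
    Finsupp.linearCombination ℝ (fun a : (D.Δ : Set V) => (a : V)) (D.coords v) = v := by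
  induction hv using AddSubmonoid.closure_induction with
  | mem ε hε => simp [D.coords_base ⟨ε, hε⟩]
  | zero => simp
  | add x y _ _ hx hy => rw [map_add, map_add, hx, hy]

lemma height_root_int {α : V} (hα : α ∈ D.R) : ∃ n : ℤ, D.height α = n := by
  rcases D.base_generates α hα with h | h
  · obtain ⟨n, hn, -⟩ := D.height_closure h
    exact ⟨n, by simp [hn]⟩
  · obtain ⟨n, hn, -⟩ := D.height_closure h
    refine ⟨-n, ?_⟩
    rw [map_neg] at hn
    push_cast
    linarith

lemma mem_Rpos {α : V} : α ∈ D.Rpos ↔ α ∈ D.R ∧ α ∈ AddSubmonoid.closure (D.Δ : Set V) := by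
  simp [Rpos]

lemma height_pos {α : V} (hα : α ∈ D.Rpos) : 0 < D.height α := by
  rw [mem_Rpos] at hα
  obtain ⟨n, hn, hn0⟩ := D.height_closure hα.2
  rw [hn]
  exact_mod_cast Nat.pos_of_ne_zero fun h => D.root_ne_zero α hα.1 (hn0 h)

lemma mem_Rpos_or_neg_mem_Rpos {α : V} (hα : α ∈ D.R) : α ∈ D.Rpos ∨ -α ∈ D.Rpos := by
  simpa only [mem_Rpos, hα, D.neg_mem α hα, true_and] using D.base_generates α hα

lemma base_mem_Rpos {α : V} (hα : α ∈ D.Δ) : α ∈ D.Rpos :=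
  D.mem_Rpos.2 ⟨D.base_subset hα, AddSubmonoid.subset_closure hα⟩

/-- A simple reflection preserves the positive roots which are not multiples of the simple root. -/
lemma refl_base_mem_Rpos {α β : V} (hα : α ∈ D.Δ) (hβ : β ∈ D.Rpos)
    (hne : ∀ t : ℝ, β ≠ t • α) : (D.refl α (D.base_subset hα)).1 β ∈ D.Rpos := by
  have hβ' := D.mem_Rpos.1 hβ
  have hex : ∃ δ : (D.Δ : Set V), δ ≠ ⟨α, hα⟩ ∧ D.coords β δ ≠ 0 := by
    by_contra! hcon
    refine hne (D.coords β ⟨α, hα⟩) ?_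
    have hs : D.coords β = Finsupp.single ⟨α, hα⟩ (D.coords β ⟨α, hα⟩) := by
      ext δ
      by_cases h : δ = ⟨α, hα⟩
      · rw [h, Finsupp.single_eq_same]
      · rw [hcon δ h, Finsupp.single_eq_of_ne h]
    conv_lhs => rw [← D.linearCombination_coords hβ'.2, hs, Finsupp.linearCombination_single]
  obtain ⟨δ, hδ, hδ0⟩ := hex
  have hpos := lt_of_le_of_ne (D.coords_nonneg hβ'.2 δ) hδ0.symm
  have hmem := D.refl_fst_mem (D.base_subset hα) hβ'.1
  refine (D.mem_Rpos_or_neg_mem_Rpos hmem).resolve_right fun hneg => ?_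
  have h := D.coords_nonneg (D.mem_Rpos.1 hneg).2 δ
  rw [refl_fst_apply, map_neg, map_sub, map_smul, D.coords_base ⟨α, hα⟩] at h
  simp only [Finsupp.neg_apply, Finsupp.sub_apply, Finsupp.smul_apply,
    Finsupp.single_eq_of_ne hδ] at h
  simp only [smul_zero, sub_zero] at h
  linarith

/-! ### Words in the simple reflections -/

/-- `D.Word n w` says that `w` is a product of `n` simple reflections. -/
inductive Word : ℕ → (V ≃ₗ[ℝ] V) × (V' ≃ₗ[ℝ] V') → Prop
  | nil : Word 0 1
  | cons {n w} (α : V) (hα : α ∈ D.Δ) (hw : Word n w) :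
      Word (n + 1) (D.refl α (D.base_subset hα) * w)

namespace Word

variable {D} {n m : ℕ} {w u : (V ≃ₗ[ℝ] V) × (V' ≃ₗ[ℝ] V')}

lemma mem_weyl (h : D.Word n w) : w ∈ D.weyl := by
  induction h with
  | nil => exact one_mem _
  | cons α hα _ ih => exact mul_mem (D.refl_mem_weyl _) ih

lemma mul (hw : D.Word n w) (hu : D.Word m u) : D.Word (n + m) (w * u) := by
  induction hw with
  | nil => simpa using hu
  | cons α hα _ ih =>
    rw [mul_assoc, add_right_comm]
    exact ih.cons α hα

lemma singleton {α : V} (hα : α ∈ D.Δ) : D.Word 1 (D.refl α (D.base_subset hα)) := by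
  simpa using Word.nil.cons α hα

lemma exists_eq_mul_refl (h : D.Word (n + 1) w) :
    ∃ u α, ∃ hα : α ∈ D.Δ, D.Word n u ∧ w = u * D.refl α (D.base_subset hα) := by
  induction n generalizing w with
  | zero =>
    obtain _ | ⟨α, hα, hw⟩ := h
    cases hw
    exact ⟨1, α, hα, .nil, by simp⟩
  | succ n ih =>
    obtain _ | ⟨α, hα, hw⟩ := h
    obtain ⟨u, β, hβ, hu, rfl⟩ := ih hw
    exact ⟨_, β, hβ, hu.cons α hα, by rw [mul_assoc]⟩

/-- The exchange property. -/
lemma exchange (h : D.Word n w) {α : V} (hα : α ∈ D.Δ) (hneg : -w.1 α ∈ D.Rpos) :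
    ∃ m, m < n ∧ D.Word m (w * D.refl α (D.base_subset hα)) := by
  induction h with
  | nil =>
    have h1 := D.height_pos hneg
    have h2 := D.height_pos (D.base_mem_Rpos hα)
    rw [map_neg] at h1
    change 0 < -D.height α at h1
    linarith
  | @cons n u β hβ hu ih =>
    have hαR := D.base_subset hα
    have huα := weyl_root_mem hu.mem_weyl hαR
    rcases D.mem_Rpos_or_neg_mem_Rpos huα with hpos | hneg'
    · by_cases hmul : ∃ t : ℝ, u.1 α = t • β
      · obtain ⟨t, ht⟩ := hmul
        have hrefl : D.refl (u.1 α) huα = D.refl β (D.base_subset hβ) := by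
          simp only [ht] at huα ⊢
          exact D.refl_smul _ huα
        refine ⟨n, Nat.lt_succ_self n, ?_⟩
        rw [mul_assoc, mul_refl hu.mem_weyl hαR, hrefl, ← mul_assoc, refl_mul_self, one_mul]
        exact hu
      · push Not at hmul
        have h1 := D.height_pos (D.refl_base_mem_Rpos hβ hpos hmul)
        have h2 := D.height_pos hneg
        rw [map_neg] at h2
        change 0 < -D.height ((D.refl β (D.base_subset hβ)).1 (u.1 α)) at h2
        linarith
    · obtain ⟨m, hm, hw⟩ := ih hneg'
      refine ⟨m + 1, by omega, ?_⟩
      rw [mul_assoc]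
      exact hw.cons β hβ

end Word

lemma exists_base_pair_pos {β : V} (hβ : β ∈ D.Rpos) :
    ∃ α ∈ D.Δ, 0 < D.pair β (D.coroot α) := by
  rw [mem_Rpos] at hβ
  by_contra! hcon
  have key : ∀ v ∈ AddSubmonoid.closure (D.Δ : Set V), D.pair v (D.coroot β) ≤ 0 := by
    intro v hv
    induction hv using AddSubmonoid.closure_induction with
    | mem α hα =>
      by_contra! h
      exact (hcon α hα).not_gt (D.pair_coroot_pos_symm (D.base_subset hα) hβ.1 h)
    | zero => simp
    | add x y _ _ hx hy =>
      rw [map_add, LinearMap.add_apply]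
      exact add_nonpos hx hy
  have := key β hβ.2
  rw [D.pair_self_eq_two β hβ.1] at this
  norm_num at this

lemma exists_word_refl_of_mem_Rpos {β : V} (hβ : β ∈ D.Rpos) :
    ∃ n, D.Word n (D.refl β (D.mem_Rpos.1 hβ).1) := by
  obtain ⟨k, hk, -⟩ := D.height_closure (D.mem_Rpos.1 hβ).2
  induction k using Nat.strong_induction_on generalizing β with
  | _ k ih =>
    obtain ⟨α, hα, hpos⟩ := D.exists_base_pair_pos hβ
    have hαR := D.base_subset hα
    by_cases hmul : ∃ t : ℝ, β = t • α
    · obtain ⟨t, rfl⟩ := hmul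
      rw [D.refl_smul hαR]
      exact ⟨1, .singleton hα⟩
    · push Not at hmul
      have hmem := D.refl_base_mem_Rpos hα hβ hmul
      obtain ⟨m, hm, -⟩ := D.height_closure (D.mem_Rpos.1 hmem).2
      have hlt : m < k := by
        have h : D.height ((D.refl α hαR).1 β) < D.height β := by
          rw [refl_fst_apply, map_sub, map_smul, D.height_base hα, smul_eq_mul, mul_one]
          linarith
        rw [hm, hk] at h
        exact_mod_cast h
      obtain ⟨n, hn⟩ := ih m hlt hmem hm
      refine ⟨1 + n + 1, ?_⟩
      have h := ((Word.singleton hα).mul hn).mul (Word.singleton hα)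
      rwa [mul_assoc, ← mul_refl (D.refl_mem_weyl hαR) (D.mem_Rpos.1 hβ).1, ← mul_assoc,
        refl_mul_self, one_mul] at h

lemma exists_word {w : (V ≃ₗ[ℝ] V) × (V' ≃ₗ[ℝ] V')} (hw : w ∈ D.weyl) : ∃ n, D.Word n w := by
  induction hw using D.weyl_induction with
  | one => exact ⟨0, .nil⟩
  | refl_mul α hα w hw ih =>
    obtain ⟨n, hn⟩ := ih
    rcases D.mem_Rpos_or_neg_mem_Rpos hα with h | h
    · obtain ⟨m, hm⟩ := D.exists_word_refl_of_mem_Rpos h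
      exact ⟨_, hm.mul hn⟩
    · obtain ⟨m, hm⟩ := D.exists_word_refl_of_mem_Rpos h
      rw [D.refl_neg hα] at hm
      exact ⟨_, hm.mul hn⟩

/-! ### The dominance order -/

section Order

variable {D}

lemma leQ_trans {x y z : V'} (hxy : D.leQ x y) (hyz : D.leQ y z) : D.leQ x z := by
  have := D.Qpos.add_mem hyz hxy
  rwa [sub_add_sub_cancel] at this

lemma coroot_mem_Qpos {α : V} (hα : α ∈ D.Rpos) : D.coroot α ∈ D.Qpos :=
  AddSubmonoid.subset_closure ⟨α, hα, rfl⟩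

lemma pair_smul_coroot_mem_Qpos {α β : V} (hα : α ∈ D.R) (hβ : β ∈ D.Rpos) {x : V'}
    (hx : x ∈ D.X) (h : 0 ≤ D.pair α x) : D.pair α x • D.coroot β ∈ D.Qpos := by
  obtain ⟨n, hn⟩ := D.pair_X_int α hα x hx
  rw [hn] at h ⊢
  obtain ⟨k, rfl⟩ := Int.eq_ofNat_of_zero_le (by exact_mod_cast h)
  rw [Int.cast_smul_eq_zsmul, natCast_zsmul]
  exact D.Qpos.nsmul_mem (coroot_mem_Qpos hβ) k

lemma Word.leQ_of_dominant {μ : V'} (hμ : μ ∈ D.Xplus) {n : ℕ}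
    {w : (V ≃ₗ[ℝ] V) × (V' ≃ₗ[ℝ] V')} (h : D.Word n w) : D.leQ (w.2 μ) μ := by
  induction n using Nat.strong_induction_on generalizing w with
  | _ n ih =>
    cases n with
    | zero =>
      cases h
      change μ - μ ∈ D.Qpos
      rw [sub_self]
      exact zero_mem _
    | succ n =>
      obtain ⟨u, α, hα, hu, rfl⟩ := h.exists_eq_mul_refl
      have hαR := D.base_subset hα
      rcases D.mem_Rpos_or_neg_mem_Rpos (weyl_root_mem hu.mem_weyl hαR) with hpos | hneg
      · refine leQ_trans ?_ (ih n (Nat.lt_succ_self n) hu)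
        change u.2 μ - u.2 ((D.refl α hαR).2 μ) ∈ D.Qpos
        rw [refl_snd_apply, map_sub, map_smul, ← coroot_weyl hu.mem_weyl hαR, sub_sub_cancel]
        exact pair_smul_coroot_mem_Qpos hαR hpos hμ.1 (hμ.2 α (D.base_mem_Rpos hα))
      · obtain ⟨m, hm, hw⟩ := hu.exchange hα hneg
        exact ih m (by omega) hw

/-- A dominant element dominates its Weyl group orbit. -/
lemma weyl_leQ_of_dominant {μ : V'} (hμ : μ ∈ D.Xplus) {w : (V ≃ₗ[ℝ] V) × (V' ≃ₗ[ℝ] V')}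
    (hw : w ∈ D.weyl) : D.leQ (w.2 μ) μ :=
  let ⟨_, h⟩ := D.exists_word hw
  h.leQ_of_dominant hμ

variable (D) in
/-- A linear form on `V'`, integral on `X`, which is positive on positive coroots. -/
def coheight : V' →ₗ[ℝ] ℝ := D.height ∘ₗ D.polarization

lemma coheight_coroot_pos {α : V} (hα : α ∈ D.Rpos) : 0 < D.coheight (D.coroot α) := by
  obtain ⟨c, hc, h⟩ := D.polarization_coroot (D.mem_Rpos.1 hα).1
  rw [coheight, LinearMap.comp_apply, h, map_smul, smul_eq_mul]
  exact mul_pos hc (D.height_pos hα)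

lemma coheight_int {x : V'} (hx : x ∈ D.X) : ∃ n : ℤ, D.coheight x = n := by
  rw [coheight, LinearMap.comp_apply, polarization_apply, map_sum]
  have h : ∀ α ∈ D.R, ∃ n : ℤ, D.height (D.pair α x • α) = n := fun α hα => by
    obtain ⟨a, ha⟩ := D.pair_X_int α hα x hx
    obtain ⟨b, hb⟩ := D.height_root_int hα
    exact ⟨a * b, by simp [ha, hb]⟩
  choose! n hn using h
  exact ⟨∑ α ∈ D.R, n α, by rw [Int.cast_sum]; exact Finset.sum_congr rfl hn⟩

lemma coheight_le {x y : V'} (h : D.leQ x y) : D.coheight x ≤ D.coheight y := by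
  rw [← sub_nonneg, ← map_sub]
  unfold leQ at h
  generalize y - x = z at h ⊢
  induction h using AddSubmonoid.closure_induction with
  | mem z hz =>
    obtain ⟨α, hα, rfl⟩ := hz
    exact (coheight_coroot_pos hα).le
  | zero => simp
  | add a b _ _ ha hb =>
    rw [map_add]
    exact add_nonneg ha hb

/-- Every element of `Ω(λ)` has a dominant conjugate. -/
lemma exists_weyl_dominant {ν lam : V'} (hν : ν ∈ D.Omega lam) :
    ∃ w ∈ D.weyl, D.Dominant (w.2 ν) := by
  have hbdd : ∃ b : ℤ, ∀ z : ℤ, (∃ w ∈ D.weyl, D.coheight (w.2 ν) = z) → z ≤ b := by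
    refine ⟨⌊D.coheight lam⌋, ?_⟩
    rintro z ⟨w, hw, hz⟩
    rw [Int.le_floor, ← hz]
    exact coheight_le (hν.2 w hw)
  have hne : ∃ z : ℤ, ∃ w ∈ D.weyl, D.coheight (w.2 ν) = z := by
    obtain ⟨z, hz⟩ := coheight_int hν.1
    exact ⟨z, 1, one_mem _, hz⟩
  obtain ⟨z, ⟨w, hw, hz⟩, hmax⟩ := Int.exists_greatest_of_bdd hbdd hne
  refine ⟨w, hw, fun α hα => ?_⟩
  have hαR := (D.mem_Rpos.1 hα).1
  have hw' := mul_mem (D.refl_mem_weyl hαR) hw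
  obtain ⟨y, hy⟩ := coheight_int (weyl_mem_X hw' hν.1)
  have hle : D.coheight ((D.refl α hαR).2 (w.2 ν)) ≤ D.coheight (w.2 ν) := by
    rw [hz]
    exact hy.trans_le (by exact_mod_cast hmax y ⟨_, hw', hy⟩)
  rw [refl_snd_apply, map_sub, map_smul, smul_eq_mul, sub_le_self_iff] at hle
  exact nonneg_of_mul_nonneg_left hle (coheight_coroot_pos hα)

/-- An element of `Ω(μ)`, for `μ` minimal, is zero or conjugate to `μ`. -/
lemma eq_zero_or_exists_weyl_of_mem_Omega {μ ν : V'} (hμ : μ ∈ D.MSet) (hν : ν ∈ D.Omega μ) :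
    ν = 0 ∨ ∃ w ∈ D.weyl, w.2 ν = μ := by
  obtain ⟨w, hw, hdom⟩ := exists_weyl_dominant hν
  by_cases h0 : w.2 ν = 0
  · exact .inl (by simpa using h0)
  · exact .inr ⟨w, hw, hμ.2.2 _ ⟨weyl_mem_X hw hν.1, hdom⟩ h0 (hν.2 w hw)⟩

/-- If `⟨γ, μ⟩ ≥ 2`, each conjugate of `μ - γ∨` is obtained from a conjugate of `μ` by subtracting
a positive coroot and an element of `Q∨₊`. -/
lemma exists_weyl_sub_coroot {μ : V'} (hμ : μ ∈ D.X) {γ : V} (hγ : γ ∈ D.R)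
    (h2 : 2 ≤ D.pair γ μ) {w : (V ≃ₗ[ℝ] V) × (V' ≃ₗ[ℝ] V')} (hw : w ∈ D.weyl) :
    ∃ u ∈ D.weyl, ∃ β ∈ D.Rpos, D.leQ (w.2 (μ - D.coroot γ)) (u.2 μ - D.coroot β) := by
  have hwγ := weyl_root_mem hw hγ
  rcases D.mem_Rpos_or_neg_mem_Rpos hwγ with hpos | hneg
  · refine ⟨w, hw, _, hpos, ?_⟩
    rw [leQ, map_sub, coroot_weyl hw hγ, sub_self]
    exact zero_mem _
  · refine ⟨w * D.refl γ hγ, mul_mem hw (D.refl_mem_weyl hγ), _, hneg, ?_⟩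
    have hx : μ - D.coroot γ ∈ D.X := D.X.sub_mem hμ (D.coroot_mem_X γ hγ)
    have h := pair_smul_coroot_mem_Qpos hγ hneg hx (by
      rw [map_sub, D.pair_self_eq_two γ hγ]
      linarith)
    change w.2 ((D.refl γ hγ).2 μ) - D.coroot (-w.1 γ) - w.2 (μ - D.coroot γ) ∈ D.Qpos
    convert h using 1
    rw [refl_snd_apply, D.coroot_neg _ hwγ, coroot_weyl hw hγ, map_sub (D.pair γ),
      D.pair_self_eq_two γ hγ, map_sub, map_sub, map_smul]
    module

lemma eq_coroot_of_two_le_pair {μ : V'} (hμ : μ ∈ D.MSet) {γ : V} (hγ : γ ∈ D.R)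
    (h2 : 2 ≤ D.pair γ μ) : μ = D.coroot γ := by
  have hX : μ - D.coroot γ ∈ D.X := D.X.sub_mem hμ.1.1 (D.coroot_mem_X γ hγ)
  have hΩ : μ - D.coroot γ ∈ D.Omega μ := by
    refine ⟨hX, fun w hw => ?_⟩
    obtain ⟨u, hu, β, hβ, hle⟩ := exists_weyl_sub_coroot hμ.1.1 hγ h2 hw
    refine leQ_trans hle (leQ_trans ?_ (weyl_leQ_of_dominant hμ.1 hu))
    rw [leQ, sub_sub_cancel]
    exact coroot_mem_Qpos hβ
  rcases eq_zero_or_exists_weyl_of_mem_Omega hμ hΩ with h0 | ⟨w, hw, hwμ⟩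
  · exact sub_eq_zero.1 h0
  · obtain ⟨u, hu, β, hβ, hle⟩ := exists_weyl_sub_coroot hμ.1.1 hγ h2 hw
    rw [hwμ] at hle
    have h1 := coheight_le hle
    have h2 := coheight_le (weyl_leQ_of_dominant hμ.1 hu)
    have h3 := coheight_coroot_pos hβ
    rw [map_sub] at h1
    linarith

lemma mem_Rpos_of_pair_pos {μ : V'} (hμ : D.Dominant μ) {γ : V} (hγ : γ ∈ D.R)
    (h : 0 < D.pair γ μ) : γ ∈ D.Rpos := by
  refine (D.mem_Rpos_or_neg_mem_Rpos hγ).resolve_right fun hneg => ?_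
  have := hμ _ hneg
  rw [map_neg, LinearMap.neg_apply] at this
  linarith

end Order

end RootSystemData

theorem quasiminuscule_weights {V V' : Type} [AddCommGroup V] [Module ℝ V] [FiniteDimensional ℝ V]
    [AddCommGroup V'] [Module ℝ V'] [FiniteDimensional ℝ V']
    (D : RootSystemData V V')
    (μ : V') (hμ : μ ∈ D.MSet) (γ : V) (hγ : γ ∈ D.R)
    (h2 : 2 ≤ D.pair γ μ) :
    D.Omega μ = D.Worbit μ ∪ {0} ∧
      ∀ α ∈ D.R, α ≠ γ → α ≠ -γ →
        (D.pair α μ = -1 ∨ D.pair α μ = 0 ∨ D.pair α μ = 1) := by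
  have hμγ := RootSystemData.eq_coroot_of_two_le_pair hμ hγ h2
  refine ⟨Set.Subset.antisymm (fun ν hν => ?_) ?_, fun α hα hne hne' => ?_⟩
  · rcases RootSystemData.eq_zero_or_exists_weyl_of_mem_Omega hμ hν with h | ⟨w, hw, h⟩
    · exact .inr h
    · refine .inl ⟨w⁻¹, inv_mem hw, ?_⟩
      rw [← h]
      exact (w.2.symm_apply_apply ν).symm
  · rintro ν (⟨w, hw, rfl⟩ | rfl)
    · exact ⟨RootSystemData.weyl_mem_X hw hμ.1.1, fun g hg =>
        RootSystemData.weyl_leQ_of_dominant hμ.1 (mul_mem hg hw)⟩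
    · refine ⟨D.X.zero_mem, fun g _ => ?_⟩
      rw [map_zero, RootSystemData.leQ, sub_zero, hμγ]
      exact RootSystemData.coroot_mem_Qpos
        (RootSystemData.mem_Rpos_of_pair_pos hμ.1.2 hγ (by linarith))
  · have hlt : ∀ β ∈ D.R, β ≠ γ → D.pair β μ < 2 := by
      intro β hβ hβγ
      by_contra! h
      exact hβγ (D.coroot_injOn hβ hγ
        ((RootSystemData.eq_coroot_of_two_le_pair hμ hβ h).symm.trans hμγ))
    have h1 := hlt α hα hne
    have h2 := hlt (-α) (D.neg_mem α hα) fun h => hne' (neg_eq_iff_eq_neg.1 h)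
    obtain ⟨n, hn⟩ := D.pair_X_int α hα μ hμ.1.1
    rw [map_neg, LinearMap.neg_apply] at h2
    rw [hn] at h1 h2 ⊢
    norm_cast at h1 h2 ⊢
    omega

end
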